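/- Let G ⊊ ℝ^n be a domain, x ∈ G and r > 0. The t-metric ball B_t(x,r) = {y ∈ G : t_G(x,y) < r} touches the boundary of G, in the sense that the Euclidean closure of B_t(x,r) intersects ∂G, if and only if r ≥ 1/2. -/

import Mathlib

noncomputable def tMetric {n : ℕ} (G : Set (EuclideanSpace ℝ (Fin n)))
    (x y : EuclideanSpace ℝ (Fin n)) : ℝ :=
  dist x y / (dist x y + Metric.infDist x (frontier G) + Metric.infDist y (frontier G))

/-- The open ball around a point of an open set `G`, with radius the distance to the frontier
of `G`, is contained in `G`. -/
theorem ball_infDist_frontier_subset {E : Type*} [SeminormedAddCommGroup E] [NormedSpace ℝ E]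
    {G : Set E} (hG : IsOpen G) {x : E} (hx : x ∈ G) :
    Metric.ball x (Metric.infDist x (frontier G)) ⊆ G := by
  rcases Metric.infDist_nonneg (x := x) (s := frontier G) |>.eq_or_lt with hd | hd
  · simp [← hd]
  refine (convex_ball x _).isPreconnected.subset_of_closure_inter_subset hG
    ⟨x, Metric.mem_ball_self hd, hx⟩ fun y hy => ?_
  by_contra hyG
  have hyF : y ∈ frontier G := hG.frontier_eq ▸ ⟨hy.1, hyG⟩
  exact (Metric.infDist_le_dist_of_mem hyF).not_gt (Metric.mem_ball'.1 hy.2)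

theorem t_balls_touch_boundary_iff {n : ℕ} (G : Set (EuclideanSpace ℝ (Fin n)))
    (hne : G.Nonempty) (hopen : IsOpen G) (hconn : IsConnected G) (hproper : G ≠ Set.univ)
    (x : EuclideanSpace ℝ (Fin n)) (hx : x ∈ G) (r : ℝ) (hr : 0 < r) :
    (closure {y | y ∈ G ∧ tMetric G x y < r} ∩ frontier G).Nonempty ↔ 1 / 2 ≤ r := by
  have hF : (frontier G).Nonempty := nonempty_frontier_iff.2 ⟨hne, hproper⟩
  have hxF : x ∉ frontier G := fun h => (hopen.frontier_eq ▸ h).2 hx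
  have hd : 0 < Metric.infDist x (frontier G) :=
    (isClosed_frontier.notMem_iff_infDist_pos hF).1 hxF
  have hden (y : EuclideanSpace ℝ (Fin n)) :
      0 < dist x y + Metric.infDist x (frontier G) + Metric.infDist y (frontier G) := by
    have := Metric.infDist_nonneg (x := y) (s := frontier G)
    positivity
  constructor
  · rintro ⟨z, hz, hzF⟩
    have hclosed : IsClosed {y | dist x y ≤
        r * (dist x y + Metric.infDist x (frontier G) + Metric.infDist y (frontier G))} :=
      isClosed_le (by fun_prop) (by
        have := Metric.continuous_infDist_pt (frontier G)
        fun_prop)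
    have hzle : dist x z ≤
        r * (dist x z + Metric.infDist x (frontier G) + Metric.infDist z (frontier G)) :=
      closure_minimal (fun y hy => ((div_lt_iff₀ (hden y)).1 hy.2).le) hclosed hz
    rw [Metric.infDist_zero_of_mem hzF] at hzle
    have hle : Metric.infDist x (frontier G) ≤ dist x z := Metric.infDist_le_dist_of_mem hzF
    by_contra! h
    nlinarith
  · intro h
    obtain ⟨z, hzF, hz⟩ := isClosed_frontier.exists_infDist_eq_dist hF x
    refine ⟨z, closure_mono (s := Metric.ball x (Metric.infDist x (frontier G))) ?_ ?_, hzF⟩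
    · intro y hy
      refine ⟨ball_infDist_frontier_subset hopen hx hy, lt_of_lt_of_le ?_ h⟩
      rw [tMetric, div_lt_iff₀ (hden y)]
      have hxy := Metric.mem_ball'.1 hy
      have := Metric.infDist_nonneg (x := y) (s := frontier G)
      linarith
    · rw [closure_ball x hd.ne', Metric.mem_closedBall', hz]
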